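/- arXiv:1303.3721 — 2 statements merged into one kernel-verified Lean document; each statement's English description precedes it below -/
import Mathlib

section
/- Let n ≥ 2 and let K be a nonempty compact convex subset of ℝⁿ. Then the function p ↦ w(K^p) = w(conv(K ∪ {p})) is convex on ℝⁿ; moreover at every point p ∉ ∂K it is differentiable, with gradient ∇w(K^p) = (2/ω_n) ∫_{N_{K^p}(p) ∩ S^{n−1}} θ dσ(θ). -/
open Set Metric MeasureTheory
open scoped RealInnerProductSpace

noncomputable section

/-- Support function of a set. -/
def suppFn {n : ℕ} (C : Set (EuclideanSpace ℝ (Fin n))) (x : EuclideanSpace ℝ (Fin n)) : ℝ :=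
  sSup ((fun y => ⟪x, y⟫) '' C)

/-- Normal cone of a set `C` at `q`. -/
def normalCone {n : ℕ} (C : Set (EuclideanSpace ℝ (Fin n))) (q : EuclideanSpace ℝ (Fin n)) :
    Set (EuclideanSpace ℝ (Fin n)) :=
  {v | ∀ y ∈ C, ⟪v, y - q⟫ ≤ 0}

/-- Tangent (support) cone of `C` at `q`. -/
def supportCone {n : ℕ} (C : Set (EuclideanSpace ℝ (Fin n))) (q : EuclideanSpace ℝ (Fin n)) :
    Set (EuclideanSpace ℝ (Fin n)) :=
  closure {v | ∃ s : ℝ, 0 ≤ s ∧ ∃ y ∈ C, v = s • (y - q)}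

/-- Cap body: convex hull of `K ∪ {p}`. -/
def capBody {n : ℕ} (K : Set (EuclideanSpace ℝ (Fin n))) (p : EuclideanSpace ℝ (Fin n)) :
    Set (EuclideanSpace ℝ (Fin n)) :=
  convexHull ℝ (K ∪ {p})

/-- Spherical Lebesgue (surface) measure on `ℝⁿ`: the `(n-1)`-dimensional Hausdorff measure. -/
def sphereMeasure (n : ℕ) : Measure (EuclideanSpace ℝ (Fin n)) := μH[(n : ℝ) - 1]

/-- Total surface measure of the unit sphere in `ℝⁿ`. -/
def sphereArea (n : ℕ) : ℝ :=
  (sphereMeasure n (sphere (0 : EuclideanSpace ℝ (Fin n)) 1)).toReal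

/-- Mean width of a set `C ⊆ ℝⁿ`. -/
def meanWidth {n : ℕ} (C : Set (EuclideanSpace ℝ (Fin n))) : ℝ :=
  (2 / sphereArea n) * ∫ θ in sphere (0 : EuclideanSpace ℝ (Fin n)) 1, suppFn C θ ∂(sphereMeasure n)

/-- Self expanding curve on `[a,b]`. -/
def SelfExpanding {n : ℕ} (a b : ℝ) (x : ℝ → EuclideanSpace ℝ (Fin n)) : Prop :=
  ContinuousOn x (Icc a b) ∧
  ∀ t₁ t₂ t₃, a ≤ t₁ → t₁ ≤ t₂ → t₂ ≤ t₃ → t₃ ≤ b → dist (x t₂) (x t₁) ≤ dist (x t₃) (x t₁)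

/-- Quasi convex family on `[a,b]`. -/
def QuasiConvexFamily {n : ℕ} (a b : ℝ) (Ω : ℝ → Set (EuclideanSpace ℝ (Fin n))) : Prop :=
  (∀ t ∈ Icc a b, (Ω t).Nonempty ∧ IsCompact (Ω t) ∧ Convex ℝ (Ω t)) ∧
  (∀ s t, a ≤ s → s < t → t ≤ b → Ω s ⊂ Ω t) ∧
  (∀ s ∈ Ico a b, ⋂ t ∈ Ioc s b, Ω t = Ω s)

/-- Connectedness of a quasi convex family. -/
def ConnectedFamily {n : ℕ} (a b : ℝ) (Ω : ℝ → Set (EuclideanSpace ℝ (Fin n))) : Prop :=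
  ∀ x ∈ Ω b \ intrinsicInterior ℝ (Ω a), ∃ t ∈ Icc a b, x ∈ intrinsicFrontier ℝ (Ω t)


section Helpers

variable {n : ℕ}

lemma suppFn_bdd (K : Set (EuclideanSpace ℝ (Fin n))) (hcomp : IsCompact K)
    (x : EuclideanSpace ℝ (Fin n)) : BddAbove ((fun y => ⟪x, y⟫) '' K) :=
  (hcomp.image (by fun_prop)).bddAbove

lemma le_suppFn {K : Set (EuclideanSpace ℝ (Fin n))} (hcomp : IsCompact K)
    (x : EuclideanSpace ℝ (Fin n)) {y} (hy : y ∈ K) : ⟪x, y⟫ ≤ suppFn K x :=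
  le_csSup (suppFn_bdd K hcomp x) (mem_image_of_mem _ hy)

lemma suppFn_le {K : Set (EuclideanSpace ℝ (Fin n))} (hne : K.Nonempty)
    (x : EuclideanSpace ℝ (Fin n)) {c : ℝ} (h : ∀ y ∈ K, ⟪x, y⟫ ≤ c) : suppFn K x ≤ c := by
  apply csSup_le (hne.image _)
  rintro _ ⟨y, hy, rfl⟩
  exact h y hy

lemma continuous_suppFn {K : Set (EuclideanSpace ℝ (Fin n))} (hcomp : IsCompact K) :
    Continuous (suppFn K) := by
  unfold suppFn
  exact hcomp.continuous_sSup (f := fun x y => ⟪x, y⟫) (by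
    simp only [Function.HasUncurry.uncurry]
    fun_prop)

lemma capBody_le {K : Set (EuclideanSpace ℝ (Fin n))} (hcomp : IsCompact K)
    (p x : EuclideanSpace ℝ (Fin n)) : ∀ y ∈ capBody K p, ⟪x, y⟫ ≤ max (suppFn K x) ⟪x, p⟫ := by
  have hc : Convex ℝ {y : EuclideanSpace ℝ (Fin n) | ⟪x, y⟫ ≤ max (suppFn K x) ⟪x, p⟫} :=
    convex_halfSpace_le (𝕜 := ℝ) (f := fun y => ⟪x, y⟫)
      ⟨fun a b => inner_add_right _ _ _, fun c a => by simp [inner_smul_right]⟩ _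
  have : capBody K p ⊆ {y : EuclideanSpace ℝ (Fin n) | ⟪x, y⟫ ≤ max (suppFn K x) ⟪x, p⟫} := by
    apply convexHull_min _ hc
    rintro y (hy | hy)
    · exact (le_suppFn hcomp x hy).trans (le_max_left _ _)
    · rw [mem_singleton_iff] at hy
      subst hy
      exact le_max_right (suppFn K x) ⟪x, y⟫
  exact fun y hy => this hy

lemma subset_capBody (K : Set (EuclideanSpace ℝ (Fin n))) (p : EuclideanSpace ℝ (Fin n)) :
    K ⊆ capBody K p := fun _ hy => subset_convexHull ℝ _ (Or.inl hy)

lemma mem_capBody (K : Set (EuclideanSpace ℝ (Fin n))) (p : EuclideanSpace ℝ (Fin n)) :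
    p ∈ capBody K p := subset_convexHull ℝ _ (Or.inr rfl)

lemma suppFn_capBody {K : Set (EuclideanSpace ℝ (Fin n))} (hne : K.Nonempty) (hcomp : IsCompact K)
    (p x : EuclideanSpace ℝ (Fin n)) : suppFn (capBody K p) x = max (suppFn K x) ⟪x, p⟫ := by
  have hb : BddAbove ((fun y => ⟪x, y⟫) '' capBody K p) := by
    refine ⟨max (suppFn K x) ⟪x, p⟫, ?_⟩
    rintro _ ⟨y, hy, rfl⟩
    exact capBody_le hcomp p x y hy
  apply le_antisymm
  · exact suppFn_le ⟨p, mem_capBody K p⟩ x (capBody_le hcomp p x)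
  · apply max_le
    · exact suppFn_le hne x fun y hy => le_csSup hb (mem_image_of_mem _ (subset_capBody K p hy))
    · exact le_csSup hb (mem_image_of_mem _ (mem_capBody K p))

lemma mem_normalCone_capBody {K : Set (EuclideanSpace ℝ (Fin n))} (hne : K.Nonempty)
    (hcomp : IsCompact K) (p x : EuclideanSpace ℝ (Fin n)) :
    x ∈ normalCone (capBody K p) p ↔ suppFn K x ≤ ⟪x, p⟫ := by
  constructor
  · intro h
    apply suppFn_le hne
    intro y hy
    have := h y (subset_capBody K p hy)
    rw [inner_sub_right] at this
    linarith
  · intro h y hy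
    have := capBody_le hcomp p x y hy
    rw [max_eq_right h] at this
    rw [inner_sub_right]
    linarith

lemma antilip_aux {u z z' : EuclideanSpace ℝ (Fin n)} (hu : ‖u‖ ≤ 1 / 4) (hz : ‖z‖ = 1)
    (hz' : ‖z'‖ = 1) :
    ‖z - z'‖ ≤ 2 * ‖‖z + u‖⁻¹ • (z + u) - ‖z' + u‖⁻¹ • (z' + u)‖ := by
  set a := z + u with ha
  set b := z' + u with hb
  have hab : z - z' = a - b := by simp [ha, hb]
  have a1 : 3 / 4 ≤ ‖a‖ := by
    have := norm_sub_le a u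
    rw [ha, add_sub_cancel_right, hz, ← ha] at this
    linarith
  have b1 : 3 / 4 ≤ ‖b‖ := by
    have := norm_sub_le b u
    rw [hb, add_sub_cancel_right, hz', ← hb] at this
    linarith
  have a2 : ‖a‖ ≤ 5 / 4 := by
    have := norm_add_le z u
    rw [← ha] at this
    linarith
  have hdiff : ‖a‖ ^ 2 - ‖b‖ ^ 2 = 2 * ⟪z - z', u⟫ := by
    rw [ha, hb, norm_add_sq_real, norm_add_sq_real, hz, hz', inner_sub_left]
    ring
  have hcs : |⟪z - z', u⟫| ≤ ‖z - z'‖ * (1 / 4) :=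
    (abs_real_inner_le_norm _ _).trans (by gcongr)
  have h3 : |‖a‖ - ‖b‖| ≤ ‖z - z'‖ / 3 := by
    have h4 : |‖a‖ - ‖b‖| * (‖a‖ + ‖b‖) = 2 * |⟪z - z', u⟫| := by
      rw [← abs_of_nonneg (show 0 ≤ ‖a‖ + ‖b‖ by positivity), ← abs_mul,
        show (‖a‖ - ‖b‖) * (‖a‖ + ‖b‖) = ‖a‖ ^ 2 - ‖b‖ ^ 2 by ring, hdiff, abs_mul]
      norm_num
    have h5 : |‖a‖ - ‖b‖| * (3 / 2) ≤ |‖a‖ - ‖b‖| * (‖a‖ + ‖b‖) := by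
      gcongr
      linarith
    linarith
  have ha0 : ‖a‖ ≠ 0 := by linarith
  have hb0 : ‖b‖ ≠ 0 := by linarith
  have key : a - b = ‖a‖ • (‖a‖⁻¹ • a - ‖b‖⁻¹ • b) + (‖a‖ - ‖b‖) • (‖b‖⁻¹ • b) := by
    rw [smul_sub, sub_smul, smul_inv_smul₀ ha0, smul_inv_smul₀ hb0]
    abel
  have h6 : ‖a - b‖ ≤ ‖a‖ * ‖‖a‖⁻¹ • a - ‖b‖⁻¹ • b‖ + |‖a‖ - ‖b‖| := by
    calc ‖a - b‖ ≤ ‖‖a‖ • (‖a‖⁻¹ • a - ‖b‖⁻¹ • b)‖ + ‖(‖a‖ - ‖b‖) • (‖b‖⁻¹ • b)‖ := by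
          conv_lhs => rw [key]
          exact norm_add_le _ _
      _ = _ := by
          rw [norm_smul, norm_smul, norm_smul, norm_norm, norm_inv, norm_norm,
            inv_mul_cancel₀ hb0, mul_one, Real.norm_eq_abs]
  have h7 : ‖a‖ * ‖‖a‖⁻¹ • a - ‖b‖⁻¹ • b‖ ≤ 5 / 4 * ‖‖a‖⁻¹ • a - ‖b‖⁻¹ • b‖ := by
    gcongr
  rw [hab] at h3 ⊢
  have := norm_nonneg (‖a‖⁻¹ • a - ‖b‖⁻¹ • b)
  linarith

lemma null_of_sublinear (hn : 2 ≤ n) (g : EuclideanSpace ℝ (Fin n) → ℝ) (hc : Continuous g)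
    (hadd : ∀ x y, g (x + y) ≤ g x + g y) (hsm : ∀ c : ℝ, 0 < c → ∀ x, g (c • x) = c * g x)
    (u : EuclideanSpace ℝ (Fin n)) (hu : g u < 0)
    (hfin : sphereMeasure n (sphere (0 : EuclideanSpace ℝ (Fin n)) 1) ≠ ⊤) :
    sphereMeasure n (sphere (0 : EuclideanSpace ℝ (Fin n)) 1 ∩ {x | g x = 0}) = 0 := by
  obtain ⟨u, hu, hu4⟩ : ∃ u, g u < 0 ∧ ‖u‖ ≤ 1 / 4 := by
    refine ⟨(4 * (‖u‖ + 1))⁻¹ • u, ?_, ?_⟩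
    · rw [hsm _ (by positivity)]
      exact mul_neg_of_pos_of_neg (by positivity) hu
    · rw [norm_smul, norm_inv, Real.norm_of_nonneg (by positivity), inv_mul_le_iff₀ (by positivity)]
      linarith [norm_nonneg u]
  have hd : (0 : ℝ) ≤ (n : ℝ) - 1 := by
    have : (2 : ℝ) ≤ n := by exact_mod_cast hn
    linarith
  set Z := sphere (0 : EuclideanSpace ℝ (Fin n)) 1 ∩ {x | g x = 0} with hZ
  have hZc : IsCompact Z := (isCompact_sphere _ _).inter_right (isClosed_eq hc continuous_const)
  let t : ℕ → ℝ := fun k => 1 / ((k : ℝ) + 1)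
  have ht0 : ∀ k, 0 < t k := fun k => by positivity
  have ht1 : ∀ k, t k ≤ 1 := fun k => by
    simp only [t]
    rw [div_le_one (by positivity)]
    linarith [(Nat.cast_nonneg k : (0 : ℝ) ≤ k)]
  have htinj : Function.Injective t := by
    intro i j hij
    simp only [t, one_div, inv_inj] at hij
    exact_mod_cast add_right_cancel hij
  have htu : ∀ k, ‖t k • u‖ ≤ 1 / 4 := fun k => by
    rw [norm_smul, Real.norm_of_nonneg (ht0 k).le]
    nlinarith [norm_nonneg u, ht1 k, ht0 k]
  let f : ℕ → EuclideanSpace ℝ (Fin n) → EuclideanSpace ℝ (Fin n) :=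
    fun k z => ‖z + t k • u‖⁻¹ • (z + t k • u)
  have hnz : ∀ k, ∀ z ∈ Z, 0 < ‖z + t k • u‖ := fun k z hz => by
    have h1 : ‖z‖ = 1 := by simpa using hz.1
    have := norm_sub_le (z + t k • u) (t k • u)
    rw [add_sub_cancel_right, h1] at this
    linarith [htu k]
  have hfcont : ∀ k, ContinuousOn (f k) Z := fun k => by
    refine ContinuousOn.smul (f := fun z => ‖z + t k • u‖⁻¹) (g := fun z => z + t k • u) ?_ ?_
    · apply ContinuousOn.inv₀ (by fun_prop)
      intro z hz
      exact (hnz k z hz).ne'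
    · fun_prop
  have hmeas : ∀ k, MeasurableSet (f k '' Z) := fun k =>
    (hZc.image_of_continuousOn (hfcont k)).measurableSet
  have hsub : ∀ k, f k '' Z ⊆ sphere (0 : EuclideanSpace ℝ (Fin n)) 1 := by
    rintro k _ ⟨z, hz, rfl⟩
    simp only [f, mem_sphere_zero_iff_norm, norm_smul, norm_inv, norm_norm]
    exact inv_mul_cancel₀ (hnz k z hz).ne'
  have hneg : ∀ z ∈ Z, ∀ z' ∈ Z, ∀ c b : ℝ, 0 < c → 0 < b → z = c • z' + b • u → False := by
    intro z hz z' hz' c b hc0 hb h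
    have h1 := hadd (c • z') (b • u)
    rw [← h, hsm c hc0, hsm b hb, hz.2, hz'.2] at h1
    nlinarith
  have hdisj : Pairwise (Function.onFun Disjoint fun k => f k '' Z) := by
    intro i j hij
    simp only [Function.onFun]
    rw [Set.disjoint_left]
    rintro _ ⟨z, hz, rfl⟩ ⟨z', hz', h⟩
    simp only [f] at h
    have hp := hnz i z hz
    have hp' := hnz j z' hz'
    set A := ‖z + t i • u‖ with hA
    set B := ‖z' + t j • u‖ with hB
    have h2 : z + t i • u = (A * B⁻¹) • (z' + t j • u) := by
      rw [mul_smul, h, smul_inv_smul₀ hp.ne']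
    set c := A * B⁻¹ with hcdef
    have hc0 : 0 < c := by positivity
    have h3 : z = c • z' + (c * t j - t i) • u := by
      rw [smul_add] at h2
      rw [sub_smul, mul_smul c (t j) u, ← add_sub_assoc, ← h2, add_sub_cancel_right]
    rcases lt_trichotomy (c * t j - t i) 0 with hlt | heq | hgt
    · refine hneg z' hz' z hz c⁻¹ (c⁻¹ * (-(c * t j - t i))) (by positivity)
        (mul_pos (by positivity) (by linarith)) ?_
      rw [mul_smul, ← smul_add, neg_smul]
      rw [eq_inv_smul_iff₀ hc0.ne']
      conv_rhs => rw [h3]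
      abel
    · rw [heq, zero_smul, add_zero] at h3
      have hc1 : c = 1 := by
        have := congrArg norm h3
        rw [norm_smul, mem_sphere_zero_iff_norm.1 hz.1, mem_sphere_zero_iff_norm.1 hz'.1,
          Real.norm_of_nonneg hc0.le] at this
        linarith
      rw [hc1] at heq
      exact hij (htinj (by linarith))
    · exact hneg z hz z' hz' c _ hc0 hgt h3
  have hle : ∀ k, sphereMeasure n Z ≤ (2 : ENNReal) ^ ((n : ℝ) - 1) * sphereMeasure n (f k '' Z) := by
    intro k
    have hal : AntilipschitzWith 2 (fun z : Z => f k z) := by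
      apply AntilipschitzWith.of_le_mul_dist
      rintro ⟨z, hz⟩ ⟨z', hz'⟩
      rw [Subtype.dist_eq, dist_eq_norm, dist_eq_norm]
      exact antilip_aux (htu k) (mem_sphere_zero_iff_norm.1 hz.1) (mem_sphere_zero_iff_norm.1 hz'.1)
    have h1 := hal.le_hausdorffMeasure_image hd univ
    have h2 : μH[(n : ℝ) - 1] ((Subtype.val : Z → _) '' univ) = μH[(n : ℝ) - 1] (univ : Set Z) :=
      isometry_subtype_coe.hausdorffMeasure_image (Or.inl hd) univ
    have h3 : (fun z : Z => f k z) '' univ = f k '' Z := by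
      ext; simp
    rw [← h2, h3, image_univ, Subtype.range_coe] at h1
    simpa [sphereMeasure] using h1
  by_contra hpos
  have hC0 : (2 : ENNReal) ^ ((n : ℝ) - 1) ≠ 0 := by simp
  have hCt : (2 : ENNReal) ^ ((n : ℝ) - 1) ≠ ⊤ := by simp
  have hle' : ∀ k, sphereMeasure n Z / (2 : ENNReal) ^ ((n : ℝ) - 1) ≤ sphereMeasure n (f k '' Z) :=
    fun k => ENNReal.div_le_of_le_mul' (hle k)
  have hsum : ∑' k, sphereMeasure n (f k '' Z) ≤
      sphereMeasure n (sphere (0 : EuclideanSpace ℝ (Fin n)) 1) := by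
    rw [← measure_iUnion hdisj hmeas]
    exact measure_mono (iUnion_subset hsub)
  have hinf : ∑' _ : ℕ, sphereMeasure n Z / (2 : ENNReal) ^ ((n : ℝ) - 1) = ⊤ :=
    ENNReal.tsum_const_eq_top_of_ne_zero (ENNReal.div_ne_zero.2 ⟨hpos, hCt⟩)
  have := (ENNReal.tsum_le_tsum hle').trans hsum
  rw [hinf] at this
  exact hfin (top_le_iff.1 this)

lemma null_contact (hn : 2 ≤ n) {K : Set (EuclideanSpace ℝ (Fin n))} (hne : K.Nonempty)
    (hcomp : IsCompact K) (hconv : Convex ℝ K)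
    (hfin : sphereMeasure n (sphere (0 : EuclideanSpace ℝ (Fin n)) 1) ≠ ⊤)
    (p : EuclideanSpace ℝ (Fin n)) (hp : p ∉ frontier K) :
    sphereMeasure n (sphere (0 : EuclideanSpace ℝ (Fin n)) 1 ∩ {x | suppFn K x - ⟪x, p⟫ = 0}) = 0 := by
  by_cases hpK : p ∈ K
  · have hint : p ∈ interior K := by
      by_contra h
      exact hp ⟨subset_closure hpK, h⟩
    obtain ⟨ε, hε, hball⟩ := Metric.mem_nhds_iff.1 (mem_interior_iff_mem_nhds.1 hint)
    convert measure_empty (μ := sphereMeasure n)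
    rw [Set.eq_empty_iff_forall_notMem]
    rintro x ⟨hx, hx0⟩
    have hx1 : ‖x‖ = 1 := mem_sphere_zero_iff_norm.1 hx
    have hm : p + (ε / 2) • x ∈ K := by
      apply hball
      simp [norm_smul, hx1, abs_of_pos hε]
      linarith
    have := le_suppFn hcomp x hm
    rw [inner_add_right, inner_smul_right, real_inner_self_eq_norm_sq, hx1] at this
    simp only [mem_ofPred_eq] at hx0
    linarith
  · obtain ⟨φ, s, hs, hsp⟩ := geometric_hahn_banach_closed_point hconv hcomp.isClosed hpK
    set u := (InnerProductSpace.toDual ℝ (EuclideanSpace ℝ (Fin n))).symm φ with hu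
    have hui : ∀ y, ⟪u, y⟫ = φ y := fun y => InnerProductSpace.toDual_symm_apply
    have hscale : ∀ c : ℝ, 0 < c → ∀ x, suppFn K (c • x) ≤ c * suppFn K x := by
      intro c hc x
      apply suppFn_le hne
      intro y hy
      rw [real_inner_smul_left]
      exact mul_le_mul_of_nonneg_left (le_suppFn hcomp x hy) hc.le
    refine null_of_sublinear hn (fun x => suppFn K x - ⟪x, p⟫) ?_ ?_ ?_ u ?_ hfin
    · exact (continuous_suppFn hcomp).sub (by fun_prop)
    · intro x y
      have : suppFn K (x + y) ≤ suppFn K x + suppFn K y := by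
        apply suppFn_le hne
        intro z hz
        rw [inner_add_left]
        exact add_le_add (le_suppFn hcomp x hz) (le_suppFn hcomp y hz)
      simp only [inner_add_left]
      linarith
    · intro c hc x
      have h1 := hscale c hc x
      have h2 := hscale c⁻¹ (inv_pos.2 hc) (c • x)
      rw [inv_smul_smul₀ hc.ne', le_inv_mul_iff₀ hc] at h2
      simp only [real_inner_smul_left]
      linarith
    · have : suppFn K u ≤ s := suppFn_le hne u fun y hy => by
        rw [hui]
        exact (hs y hy).le
      simp only [hui]
      linarith

end Helpers

/-- convexity and differentiability of `p ↦ w(Kᵖ)`. -/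
theorem meanWidth_capBody_convexOn_hasGradientAt {n : ℕ} (hn : 2 ≤ n)
    (K : Set (EuclideanSpace ℝ (Fin n)))
    (hne : K.Nonempty) (hcomp : IsCompact K) (hconv : Convex ℝ K) :
    ConvexOn ℝ Set.univ (fun p => meanWidth (capBody K p)) ∧
    ∀ p : EuclideanSpace ℝ (Fin n), p ∉ frontier K →
      HasGradientAt (fun q => meanWidth (capBody K q))
        ((2 / sphereArea n) •
          ∫ θ in sphere (0 : EuclideanSpace ℝ (Fin n)) 1 ∩ normalCone (capBody K p) p,
            θ ∂(sphereMeasure n)) p := by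
  by_cases hfin : sphereMeasure n (sphere (0 : EuclideanSpace ℝ (Fin n)) 1) = ⊤
  · have h0 : sphereArea n = 0 := by simp [sphereArea, hfin]
    have hw : (fun p => meanWidth (capBody K p)) = fun _ => 0 := by
      funext p
      simp [meanWidth, h0]
    rw [hw, h0]
    refine ⟨convexOn_const 0 convex_univ, fun p _ => ?_⟩
    simpa using hasGradientAt_const p (0 : ℝ)
  have hfm : IsFiniteMeasure
      ((sphereMeasure n).restrict (sphere (0 : EuclideanSpace ℝ (Fin n)) 1)) :=
    ⟨by simpa using lt_top_iff_ne_top.2 hfin⟩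
  set μ := (sphereMeasure n).restrict (sphere (0 : EuclideanSpace ℝ (Fin n)) 1) with hμ
  have hw : (fun p => meanWidth (capBody K p)) =
      fun p => (2 / sphereArea n) * ∫ θ, max (suppFn K θ) ⟪θ, p⟫ ∂μ := by
    funext p
    simp [meanWidth, suppFn_capBody hne hcomp, hμ]
  have hcK := continuous_suppFn hcomp
  have hFc : ∀ p, Continuous fun θ => max (suppFn K θ) ⟪θ, p⟫ := fun p =>
    hcK.max (by fun_prop)
  have hsph : ∀ᵐ θ ∂μ, ‖θ‖ = 1 := by
    filter_upwards [ae_restrict_mem (isClosed_sphere.measurableSet)] with θ hθ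
    exact mem_sphere_zero_iff_norm.1 hθ
  have hFi : ∀ p, Integrable (fun θ => max (suppFn K θ) ⟪θ, p⟫) μ := fun p => by
    obtain ⟨C, hC⟩ := (isCompact_sphere (0 : EuclideanSpace ℝ (Fin n)) 1).exists_bound_of_continuousOn
      (hFc p).continuousOn
    refine Integrable.of_bound (hFc p).aestronglyMeasurable C ?_
    filter_upwards [hsph] with θ hθ
    exact hC θ (mem_sphere_zero_iff_norm.2 hθ)
  have hcoef : 0 ≤ 2 / sphereArea n := div_nonneg zero_le_two ENNReal.toReal_nonneg
  rw [hw]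
  constructor
  · refine ⟨convex_univ, fun x _ y _ a b ha hb hab => ?_⟩
    simp only [smul_eq_mul]
    have : ∫ θ, max (suppFn K θ) ⟪θ, a • x + b • y⟫ ∂μ ≤
        a * ∫ θ, max (suppFn K θ) ⟪θ, x⟫ ∂μ + b * ∫ θ, max (suppFn K θ) ⟪θ, y⟫ ∂μ := by
      rw [← integral_const_mul, ← integral_const_mul,
        ← integral_add ((hFi x).const_mul a) ((hFi y).const_mul b)]
      refine integral_mono (hFi _) (((hFi x).const_mul a).add ((hFi y).const_mul b)) fun θ => ?_
      simp only [inner_add_right, inner_smul_right]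
      have hx1 := mul_le_mul_of_nonneg_left (le_max_left (suppFn K θ) ⟪θ, x⟫) ha
      have hx2 := mul_le_mul_of_nonneg_left (le_max_right (suppFn K θ) ⟪θ, x⟫) ha
      have hy1 := mul_le_mul_of_nonneg_left (le_max_left (suppFn K θ) ⟪θ, y⟫) hb
      have hy2 := mul_le_mul_of_nonneg_left (le_max_right (suppFn K θ) ⟪θ, y⟫) hb
      have hs : suppFn K θ = a * suppFn K θ + b * suppFn K θ := by rw [← add_mul, hab, one_mul]
      apply max_le <;> linarith
    nlinarith [mul_le_mul_of_nonneg_left this hcoef]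
  · intro p hp
    set N := normalCone (capBody K p) p with hN
    have hNeq : N = {x | suppFn K x ≤ ⟪x, p⟫} := by
      ext x
      exact mem_normalCone_capBody hne hcomp p x
    have hNm : MeasurableSet N := by
      rw [hNeq]
      exact (isClosed_le hcK (by fun_prop)).measurableSet
    have hnull : ∀ᵐ θ ∂μ, suppFn K θ ≠ ⟪θ, p⟫ := by
      have h1 := null_contact hn hne hcomp hconv hfin p hp
      rw [ae_iff, hμ, Measure.restrict_apply']
      · convert h1 using 2
        ext x
        simp [sub_eq_zero, and_comm]
      · exact isClosed_sphere.measurableSet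
    let v : EuclideanSpace ℝ (Fin n) → EuclideanSpace ℝ (Fin n) := N.indicator id
    have hvm : Measurable v := measurable_id.indicator hNm
    have hvi : Integrable v μ := by
      refine Integrable.of_bound hvm.aestronglyMeasurable 1 ?_
      filter_upwards [hsph] with θ hθ
      exact (norm_indicator_le_norm_self _ _).trans hθ.le
    let F' : EuclideanSpace ℝ (Fin n) → (EuclideanSpace ℝ (Fin n) →L[ℝ] ℝ) :=
      fun θ => innerSL ℝ (v θ)
    have hF'm : AEStronglyMeasurable F' μ :=
      (innerSL ℝ).continuous.comp_aestronglyMeasurable hvm.aestronglyMeasurable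
    obtain ⟨hF'i, hder⟩ := hasFDerivAt_integral_of_dominated_loc_of_lip' (𝕜 := ℝ) (μ := μ) (x₀ := p)
      (F := fun q θ => max (suppFn K θ) ⟪θ, q⟫) (F' := F') (s := univ) (bound := fun _ => 1)
      Filter.univ_mem (fun q _ => (hFc q).aestronglyMeasurable) (hFi p) hF'm
      (by
        filter_upwards [hsph] with θ hθ q _
        rw [Real.norm_eq_abs]
        calc |max (suppFn K θ) ⟪θ, q⟫ - max (suppFn K θ) ⟪θ, p⟫| ≤ |⟪θ, q⟫ - ⟪θ, p⟫| := by
              simpa using abs_max_sub_max_le_max (suppFn K θ) ⟪θ, q⟫ (suppFn K θ) ⟪θ, p⟫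
          _ ≤ 1 * ‖q - p‖ := by
              rw [← inner_sub_right, ← hθ]
              exact abs_real_inner_le_norm _ _)
      (integrable_const _)
      (by
        filter_upwards [hnull] with θ hθ
        have hci : ContinuousAt (fun q : EuclideanSpace ℝ (Fin n) => ⟪θ, q⟫) p := by fun_prop
        rcases lt_or_gt_of_ne hθ with hlt | hgt
        · have hv : v θ = θ := indicator_of_mem (by rw [hNeq]; exact hlt.le) _
          have : HasFDerivAt (fun q => ⟪θ, q⟫) (F' θ) p := by
            simp only [F', hv]
            exact (innerSL ℝ θ).hasFDerivAt
          refine this.congr_of_eventuallyEq ?_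
          filter_upwards [hci.eventually (lt_mem_nhds hlt)] with q hq
          exact max_eq_right (le_of_lt hq)
        · have hv : v θ = 0 := indicator_of_notMem (by rw [hNeq]; exact not_le.2 hgt) _
          have : HasFDerivAt (fun _ => suppFn K θ) (F' θ) p := by
            simp only [F', hv, map_zero]
            exact hasFDerivAt_const _ _
          refine this.congr_of_eventuallyEq ?_
          filter_upwards [hci.eventually (gt_mem_nhds hgt)] with q hq
          exact max_eq_left (le_of_lt hq))
    have hint : ∫ θ in sphere (0 : EuclideanSpace ℝ (Fin n)) 1 ∩ N, θ ∂(sphereMeasure n)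
        = ∫ θ, v θ ∂μ := by
      rw [integral_indicator hNm, hμ, Measure.restrict_restrict hNm, inter_comm]
      rfl
    rw [hint, hasGradientAt_iff_hasFDerivAt]
    refine (hder.const_mul (2 / sphereArea n)).congr_fderiv (ContinuousLinearMap.ext fun w => ?_)
    symm
    rw [InnerProductSpace.toDual_apply_apply, real_inner_smul_left,
      smul_apply, ContinuousLinearMap.integral_apply hF'i, smul_eq_mul]
    congr 1
    rw [real_inner_comm, ← integral_inner hvi]
    simp only [F', innerSL_apply_apply, real_inner_comm]

end
end

section
/- For every n ≥ 1 there exists a constant c_n > 0, depending only on n, such that for every self-expanding curve x : [a,b] → ℝⁿ and all a ≤ t₁ ≤ t₂ ≤ b one has |x(t₂) − x(t₁)| ≤ c_n · ( w(conv(x([a,t₂]))) − w(conv(x([a,t₁]))) ); in particular every self-expanding curve is rectifiable and its total variation satisfies Var(x; [a,b]) ≤ c_n · w(conv(x([a,b]))). -/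
open Set Metric MeasureTheory
open scoped RealInnerProductSpace

noncomputable section

lemma aux_dir (n : ℕ) : ∃ δ : ℝ, 0 < δ ∧ ∀ U : Set (EuclideanSpace ℝ (Fin n)), U.Nonempty →
    (∀ u ∈ U, u ≠ 0) → (∀ u ∈ U, ∀ v ∈ U, 0 ≤ ⟪u, v⟫) →
    ∃ w : EuclideanSpace ℝ (Fin n), ‖w‖ = 1 ∧ ∀ u ∈ U, δ * ‖u‖ ≤ ⟪w, u⟫ := by
  classical
  obtain ⟨t, -, htf, hcov⟩ := finite_cover_balls_of_compact
    (isCompact_sphere (0 : EuclideanSpace ℝ (Fin n)) 1) (show (0:ℝ) < 1/2 by norm_num)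
  lift t to Finset (EuclideanSpace ℝ (Fin n)) using htf
  refine ⟨1 / (2 * ((t.card : ℝ) + 1)), by positivity, fun U hne h0 hU => ?_⟩
  have key : ∀ c : EuclideanSpace ℝ (Fin n), ∃ f : EuclideanSpace ℝ (Fin n), ‖f‖ ≤ 1 ∧
      (∀ u ∈ U, 0 ≤ ⟪f, u⟫) ∧
      (∀ u ∈ U, (‖u‖⁻¹ • u) ∈ ball c (1/2) → ‖u‖ / 2 ≤ ⟪f, u⟫) := by
    intro c
    by_cases h : ∃ v ∈ U, (‖v‖⁻¹ • v) ∈ ball c (1/2)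
    · obtain ⟨v, hv, hvc⟩ := h
      refine ⟨‖v‖⁻¹ • v, ?_, ?_, ?_⟩
      · exact (norm_smul_inv_norm (𝕜 := ℝ) (h0 v hv)).le
      · intro u hu
        rw [real_inner_smul_left]
        exact mul_nonneg (by positivity) (hU v hv u hu)
      · intro u hu huc
        have hd : ‖‖v‖⁻¹ • v - ‖u‖⁻¹ • u‖ ≤ 1 := by
          rw [← dist_eq_norm]
          have := dist_triangle_right (‖v‖⁻¹ • v) (‖u‖⁻¹ • u) c
          rw [mem_ball] at hvc huc
          linarith
        have e1 : ‖‖v‖⁻¹ • v‖ = 1 := norm_smul_inv_norm (𝕜 := ℝ) (h0 v hv)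
        have e2 : ‖‖u‖⁻¹ • u‖ = 1 := norm_smul_inv_norm (𝕜 := ℝ) (h0 u hu)
        have e3 := norm_sub_sq_real (‖v‖⁻¹ • v) (‖u‖⁻¹ • u)
        rw [e1, e2, real_inner_smul_right] at e3
        have hun : 0 < ‖u‖ := norm_pos_iff.2 (h0 u hu)
        have h4 : ‖‖v‖⁻¹ • v - ‖u‖⁻¹ • u‖ ^ 2 ≤ 1 := by
          nlinarith [norm_nonneg (‖v‖⁻¹ • v - ‖u‖⁻¹ • u)]
        have h5 : (1:ℝ)/2 ≤ ‖u‖⁻¹ * ⟪‖v‖⁻¹ • v, u⟫ := by linarith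
        rw [inv_mul_eq_div, le_div_iff₀ hun] at h5
        linarith
    · push Not at h
      refine ⟨0, by simp, by simp, fun u hu huc => absurd huc (h u hu)⟩
  choose f hf1 hf2 hf3 using key
  set S := ∑ c ∈ t, f c with hS
  have hSn : ‖S‖ ≤ t.card := by
    refine (norm_sum_le _ _).trans ?_
    refine (Finset.sum_le_sum (fun c _ => hf1 c)).trans ?_
    simp
  have hSu : ∀ u ∈ U, ‖u‖ / 2 ≤ ⟪S, u⟫ := by
    intro u hu
    have e2 : ‖‖u‖⁻¹ • u‖ = 1 := norm_smul_inv_norm (𝕜 := ℝ) (h0 u hu)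
    have := hcov (show ‖u‖⁻¹ • u ∈ sphere (0 : EuclideanSpace ℝ (Fin n)) 1 by
      rw [mem_sphere_zero_iff_norm]; exact e2)
    simp only [mem_iUnion] at this
    obtain ⟨c, hc, huc⟩ := this
    rw [hS, sum_inner]
    exact (hf3 c u hu huc).trans
      (Finset.single_le_sum (f := fun c => ⟪f c, u⟫) (fun c _ => hf2 c u hu) hc)
  have hS0 : S ≠ 0 := by
    obtain ⟨u, hu⟩ := hne
    intro h
    have h1 := hSu u hu
    have := norm_pos_iff.2 (h0 u hu)
    rw [h, inner_zero_left] at h1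
    linarith
  refine ⟨‖S‖⁻¹ • S, norm_smul_inv_norm (𝕜 := ℝ) hS0, fun u hu => ?_⟩
  have hSp := norm_pos_iff.2 hS0
  rw [real_inner_smul_left, inv_mul_eq_div, le_div_iff₀ hSp]
  refine le_trans ?_ (hSu u hu)
  rw [one_div, mul_assoc, inv_mul_eq_div, div_le_iff₀ (by positivity)]
  nlinarith [norm_nonneg u]

lemma aux_normalize {E : Type*} [NormedAddCommGroup E] [NormedSpace ℝ E] (x y : E)
    (hx : 1 ≤ ‖x‖) (hy : 1 ≤ ‖y‖) : ‖‖x‖⁻¹ • x - ‖y‖⁻¹ • y‖ ≤ 2 * ‖x - y‖ := by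
  have hx0 : 0 < ‖x‖ := by linarith
  have hy0 : 0 < ‖y‖ := by linarith
  have e : ‖x‖⁻¹ • x - ‖y‖⁻¹ • y = ‖x‖⁻¹ • (x - y) + (‖x‖⁻¹ * (‖y‖ - ‖x‖)) • (‖y‖⁻¹ • y) := by
    rw [smul_smul, smul_sub, sub_add, ← sub_smul]
    congr 2
    field_simp
    ring
  rw [e]
  have hi : ‖x‖⁻¹ ≤ 1 := inv_le_one_of_one_le₀ hx
  have hyn : ‖‖y‖⁻¹ • y‖ = 1 := norm_smul_inv_norm (𝕜 := ℝ) (norm_pos_iff.1 hy0)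
  refine (norm_add_le _ _).trans ?_
  rw [norm_smul, norm_smul, norm_mul, hyn, norm_inv, norm_norm, Real.norm_eq_abs]
  have h3 : |‖y‖ - ‖x‖| ≤ ‖x - y‖ := by rw [norm_sub_rev]; exact abs_norm_sub_norm_le y x
  have : 0 ≤ ‖x‖⁻¹ := by positivity
  nlinarith [norm_nonneg (x - y), abs_nonneg (‖y‖ - ‖x‖)]

lemma aux_face (k : ℕ) (i : Fin (k+1)) (s : ℝ) (hs : |s| = 1) :
    LipschitzWith (2 * ((k+1:ℕ):NNReal)) (fun z : Fin k → ℝ =>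
      (‖(WithLp.toLp 2 (i.insertNth (α := fun _ => ℝ) s z) : EuclideanSpace ℝ (Fin (k+1)))‖⁻¹ •
        (WithLp.toLp 2 (i.insertNth (α := fun _ => ℝ) s z) : EuclideanSpace ℝ (Fin (k+1))))) := by
  have hn : ∀ z : Fin k → ℝ, 1 ≤
      ‖(WithLp.toLp 2 (i.insertNth (α := fun _ => ℝ) s z) : EuclideanSpace ℝ (Fin (k+1)))‖ := by
    intro z
    have := PiLp.norm_apply_le (WithLp.toLp 2 (i.insertNth (α := fun _ => ℝ) s z) : EuclideanSpace ℝ (Fin (k+1))) i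
    simpa [hs] using this
  refine LipschitzWith.of_dist_le_mul fun z z' => ?_
  rw [dist_eq_norm]
  refine (aux_normalize _ _ (hn z) (hn z')).trans ?_
  rw [← dist_eq_norm]
  have h1 : dist (WithLp.toLp 2 (i.insertNth (α := fun _ => ℝ) s z) : EuclideanSpace ℝ (Fin (k+1)))
     (WithLp.toLp 2 (i.insertNth (α := fun _ => ℝ) s z')) ≤ ((k+1:ℕ):ℝ) * dist z z' := by
    rw [EuclideanSpace.dist_eq]
    apply Real.sqrt_le_iff.2
    refine ⟨by positivity, ?_⟩
    refine (Finset.sum_le_card_nsmul _ _ (dist z z' ^ 2) ?_).trans ?_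
    · intro j _
      refine pow_le_pow_left₀ dist_nonneg ?_ 2
      refine (dist_le_pi_dist (i.insertNth (α := fun _ => ℝ) s z) (i.insertNth (α := fun _ => ℝ) s z') j).trans ?_
      rw [Fin.dist_insertNth_insertNth]; simp
    · simp only [Finset.card_univ, Fintype.card_fin, nsmul_eq_mul]
      have : (1:ℝ) ≤ ((k+1:ℕ):ℝ) := by simp
      have h2 := sq_nonneg (dist z z')
      rw [mul_pow]
      apply mul_le_mul_of_nonneg_right _ h2
      nlinarith
  push_cast at h1 ⊢
  linarith

lemma aux_finite (k : ℕ) : (μH[(k:ℝ)] : Measure (EuclideanSpace ℝ (Fin (k+1)))) (sphere 0 1) < ⊤ := by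
  let F : Fin (k+1) → ℝ → (Fin k → ℝ) → EuclideanSpace ℝ (Fin (k+1)) := fun i s z => 
     (‖(WithLp.toLp 2 (i.insertNth (α := fun _ => ℝ) s z) : EuclideanSpace ℝ (Fin (k+1)))‖⁻¹ •
        (WithLp.toLp 2 (i.insertNth (α := fun _ => ℝ) s z) : EuclideanSpace ℝ (Fin (k+1))))
  have hF : ∀ i s, |s| = 1 → (μH[(k:ℝ)] : Measure (EuclideanSpace ℝ (Fin (k+1)))) (F i s '' closedBall 0 1) < ⊤ := by
    intro i s hs
    refine ((aux_face k i s hs).hausdorffMeasure_image_le (Nat.cast_nonneg k) _).trans_lt ?_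
    have : (μH[(k:ℝ)] : Measure (Fin k → ℝ)) = volume := by
      have := hausdorffMeasure_pi_real (ι := Fin k); rwa [Fintype.card_fin] at this
    rw [this]
    refine ENNReal.mul_lt_top ?_ measure_closedBall_lt_top
    exact ENNReal.rpow_lt_top_of_nonneg (Nat.cast_nonneg k) ENNReal.coe_ne_top
  have hsub : sphere (0 : EuclideanSpace ℝ (Fin (k+1))) 1 ⊆
     (⋃ i, F i 1 '' closedBall 0 1) ∪ (⋃ i, F i (-1) '' closedBall 0 1) := by
    intro x hx
    rw [mem_sphere_zero_iff_norm] at hx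
    obtain ⟨i, -, hi⟩ := Finset.exists_max_image Finset.univ (fun i => |x i|) ⟨0, Finset.mem_univ _⟩
    have hm : 0 < |x i| := by
      by_contra h
      have : x = 0 := by
        ext j
        have := hi j (Finset.mem_univ _)
        exact abs_nonpos_iff.1 (this.trans (not_lt.1 h))
      simp [this] at hx
    have hmem : (fun j => (|x i|)⁻¹ * x (i.succAbove j)) ∈ closedBall (0 : Fin k → ℝ) 1 := by
      rw [mem_closedBall_zero_iff, pi_norm_le_iff_of_nonneg zero_le_one]
      intro j
      rw [norm_mul, norm_inv, Real.norm_eq_abs, abs_abs, inv_mul_eq_div, div_le_one hm]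
      exact hi _ (Finset.mem_univ _)
    have hFx : F i ((|x i|)⁻¹ * x i) (fun j => (|x i|)⁻¹ * x (i.succAbove j)) = x := by
      have : (WithLp.toLp 2 (i.insertNth (α := fun _ => ℝ) ((|x i|)⁻¹ * x i) (fun j => (|x i|)⁻¹ * x (i.succAbove j))) : EuclideanSpace ℝ (Fin (k+1))) = (|x i|)⁻¹ • x := by
        ext j
        refine Fin.succAboveCases i ?_ (fun j => ?_) j
        · simp
        · simp
      simp only [F, this, norm_smul, hx, norm_inv, Real.norm_eq_abs, abs_abs, mul_one, inv_inv, smul_smul]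
      rw [mul_inv_cancel₀ hm.ne', one_smul]
    rcases le_or_gt 0 (x i) with h | h
    · left
      rw [abs_of_nonneg h] at hm hFx hmem
      rw [inv_mul_cancel₀ hm.ne'] at hFx
      exact mem_iUnion.2 ⟨i, _, hmem, hFx⟩
    · right
      rw [abs_of_neg h] at hm hFx hmem
      have : (-x i)⁻¹ * x i = -1 := by
        rw [inv_neg, neg_mul, inv_mul_cancel₀ h.ne]
      rw [this] at hFx
      exact mem_iUnion.2 ⟨i, _, hmem, hFx⟩
  refine (measure_mono hsub).trans_lt ?_
  refine (measure_union_le _ _).trans_lt (ENNReal.add_lt_top.2 ⟨?_, ?_⟩)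
  · refine (measure_iUnion_fintype_le _ _).trans_lt (ENNReal.sum_lt_top.2 fun i _ => hF i 1 (by simp))
  · refine (measure_iUnion_fintype_le _ _).trans_lt (ENNReal.sum_lt_top.2 fun i _ => hF i (-1) (by simp))

lemma aux_pos (k : ℕ) : 0 < (μH[(k:ℝ)] : Measure (EuclideanSpace ℝ (Fin (k+1)))) (sphere 0 1) := by
  let P : EuclideanSpace ℝ (Fin (k+1)) → (Fin k → ℝ) := fun x j => x j.castSucc
  have hP : LipschitzWith 1 P := by
    refine LipschitzWith.of_dist_le_mul fun x y => ?_
    rw [NNReal.coe_one, one_mul, dist_pi_le_iff dist_nonneg]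
    intro j
    have := PiLp.norm_apply_le (x - y) j.castSucc
    simpa [P, dist_eq_norm] using this
  have h1 := hP.hausdorffMeasure_image_le (Nat.cast_nonneg k) (sphere 0 1)
  have : (μH[(k:ℝ)] : Measure (Fin k → ℝ)) = volume := by
    have := hausdorffMeasure_pi_real (ι := Fin k); rwa [Fintype.card_fin] at this
  rw [this] at h1
  simp only [ENNReal.coe_one, ENNReal.one_rpow, one_mul] at h1
  refine lt_of_lt_of_le ?_ h1
  have hr : (0:ℝ) < 1 / (k+1) := by positivity
  refine (measure_ball_pos volume (0 : Fin k → ℝ) hr).trans_le (measure_mono ?_)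
  intro z hz
  rw [mem_ball_zero_iff, pi_norm_lt_iff hr] at hz
  have hs : ∑ j, z j ^ 2 ≤ 1 := by
    refine (Finset.sum_le_card_nsmul _ _ (1 / ((k:ℝ)+1)) ?_).trans ?_
    · intro j _
      have := (hz j).le
      rw [Real.norm_eq_abs] at this
      rw [← sq_abs]
      have h1 : (1:ℝ)/(k+1) ≤ 1 := by
        rw [div_le_one (by positivity)]; linarith [(Nat.cast_nonneg k : (0:ℝ) ≤ k)]
      nlinarith [abs_nonneg (z j)]
    · simp only [Finset.card_univ, Fintype.card_fin, nsmul_eq_mul]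
      rw [mul_one_div, div_le_one (by positivity)]; linarith
  refine ⟨WithLp.toLp 2 (Fin.snoc (α := fun _ => ℝ) z (Real.sqrt (1 - ∑ j, z j ^ 2))), ?_, ?_⟩
  · rw [mem_sphere_zero_iff_norm, EuclideanSpace.norm_eq, Fin.sum_univ_castSucc]
    simp only [Fin.snoc_castSucc, Fin.snoc_last, Real.norm_eq_abs, sq_abs]
    rw [Real.sq_sqrt (by linarith)]
    simp
  · ext j; simp [P]

lemma aux_cap (k : ℕ) (r : ℝ) (hr : 0 < r) : ∃ m : ENNReal, 0 < m ∧ 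
    ∀ v : EuclideanSpace ℝ (Fin (k+1)), ‖v‖ = 1 →
      m ≤ (μH[(k:ℝ)] : Measure (EuclideanSpace ℝ (Fin (k+1)))) (sphere 0 1 ∩ ball v r) := by
  have hinv : ∀ v w : EuclideanSpace ℝ (Fin (k+1)), ‖v‖ = 1 → ‖w‖ = 1 → 
     (μH[(k:ℝ)] : Measure (EuclideanSpace ℝ (Fin (k+1)))) (sphere 0 1 ∩ ball v r) ≤ (μH[(k:ℝ)] : Measure (EuclideanSpace ℝ (Fin (k+1)))) (sphere 0 1 ∩ ball w r) := by
    intro v w hv hw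
    set R := (ℝ ∙ (v - w))ᗮ.reflection with hR
    have hRv : R v = w := Submodule.reflection_sub (by rw [hv, hw])
    rw [← R.toIsometryEquiv.hausdorffMeasure_image]
    refine measure_mono ?_
    rintro _ ⟨x, ⟨hx, hxv⟩, rfl⟩
    simp only [mem_sphere_zero_iff_norm, mem_ball, mem_inter_iff, LinearIsometryEquiv.coe_toIsometryEquiv] at *
    refine ⟨by simpa using hx, ?_⟩
    rw [← hRv, R.dist_map]; exact hxv
  obtain ⟨t, hts, htf, hcov⟩ := finite_cover_balls_of_compact
    (isCompact_sphere (0 : EuclideanSpace ℝ (Fin (k+1))) 1) hr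
  have hex : ∃ c ∈ t, 0 < (μH[(k:ℝ)] : Measure (EuclideanSpace ℝ (Fin (k+1)))) (sphere 0 1 ∩ ball c r) := by
    by_contra! h
    have : (μH[(k:ℝ)] : Measure (EuclideanSpace ℝ (Fin (k+1)))) (⋃ c ∈ t, (sphere 0 1 ∩ ball c r)) = 0 :=
      (measure_biUnion_null_iff htf.countable).2 fun c hc => le_antisymm (h c hc) bot_le
    refine (aux_pos k).ne' (measure_mono_null ?_ this)
    intro x hx
    have := hcov hx
    simp only [mem_iUnion] at this ⊢
    obtain ⟨c, hc, hxc⟩ := this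
    exact ⟨c, hc, hx, hxc⟩
  obtain ⟨c, hc, hpos⟩ := hex
  exact ⟨_, hpos, fun v hv => hinv c v (by simpa using hts hc) hv⟩

lemma aux_bdd {n : ℕ} {C : Set (EuclideanSpace ℝ (Fin n))} (hC : Bornology.IsBounded C)
    (θ : EuclideanSpace ℝ (Fin n)) : BddAbove ((fun y => ⟪θ, y⟫) '' C) := by
  obtain ⟨R, hR⟩ := hC.exists_norm_le
  refine ⟨‖θ‖ * R, ?_⟩
  rintro _ ⟨y, hy, rfl⟩
  exact (real_inner_le_norm θ y).trans (mul_le_mul_of_nonneg_left (hR y hy) (norm_nonneg _))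

lemma aux_le_supp {n : ℕ} {C : Set (EuclideanSpace ℝ (Fin n))} (hC : Bornology.IsBounded C)
    (θ y : EuclideanSpace ℝ (Fin n)) (hy : y ∈ C) : ⟪θ, y⟫ ≤ suppFn C θ :=
  le_csSup (aux_bdd hC θ) ⟨y, hy, rfl⟩

lemma aux_supp_hull_le {n : ℕ} {S : Set (EuclideanSpace ℝ (Fin n))} (hS : S.Nonempty)
    (θ : EuclideanSpace ℝ (Fin n)) (B : ℝ) (h : ∀ y ∈ S, ⟪θ, y⟫ ≤ B) :
    suppFn (convexHull ℝ S) θ ≤ B := by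
  refine csSup_le (hS.convexHull.image _) ?_
  rintro _ ⟨y, hy, rfl⟩
  have hc : Convex ℝ {y : EuclideanSpace ℝ (Fin n) | ⟪θ, y⟫ ≤ B} :=
    convex_halfSpace_le (innerₗ (EuclideanSpace ℝ (Fin n)) θ).isLinear B
  exact convexHull_min h hc hy

lemma aux_supp_lip {n : ℕ} {C : Set (EuclideanSpace ℝ (Fin n))} (hC : Bornology.IsBounded C)
    (hne : C.Nonempty) : Continuous (suppFn C) := by
  obtain ⟨R, hR⟩ := hC.exists_norm_le
  obtain ⟨y0, hy0⟩ := hne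
  have hR0 : 0 ≤ R := (norm_nonneg _).trans (hR y0 hy0)
  have : LipschitzWith ⟨R, hR0⟩ (suppFn C) := by
    refine LipschitzWith.of_le_add_mul _ fun θ θ' => ?_
    refine csSup_le (⟨_, y0, hy0, rfl⟩) ?_
    rintro _ ⟨y, hy, rfl⟩
    have h1 := aux_le_supp hC θ' y hy
    have h2 : ⟪θ, y⟫ = ⟪θ', y⟫ + ⟪θ - θ', y⟫ := by rw [inner_sub_left]; ring
    have h3 := real_inner_le_norm (θ - θ') y
    have h4 := mul_le_mul_of_nonneg_left (hR y hy) (norm_nonneg (θ - θ'))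
    simp only [h2, dist_eq_norm]
    change _ ≤ suppFn C θ' + R * ‖θ - θ'‖
    linarith
  exact this.continuous

lemma aux_int {n : ℕ} {C : Set (EuclideanSpace ℝ (Fin n))} (hC : Bornology.IsBounded C)
    (hne : C.Nonempty)
    (hfin : sphereMeasure n (sphere (0 : EuclideanSpace ℝ (Fin n)) 1) < ⊤) :
    IntegrableOn (suppFn C) (sphere (0 : EuclideanSpace ℝ (Fin n)) 1) (sphereMeasure n) := by
  have hc := aux_supp_lip hC hne
  obtain ⟨M, hM⟩ := (isCompact_sphere (0 : EuclideanSpace ℝ (Fin n)) 1).exists_bound_of_continuousOn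
    hc.continuousOn
  exact IntegrableOn.of_bound hfin hc.aestronglyMeasurable M
    ((ae_restrict_iff' isClosed_sphere.measurableSet).2 (Filter.Eventually.of_forall hM))

lemma aux_point {n : ℕ} (p : EuclideanSpace ℝ (Fin n)) :
    meanWidth ({p} : Set (EuclideanSpace ℝ (Fin n))) = 0 := by
  have hmp : MeasurePreserving (fun x : EuclideanSpace ℝ (Fin n) => -x)
      (sphereMeasure n) (sphereMeasure n) :=
    (LinearIsometryEquiv.neg ℝ (E := EuclideanSpace ℝ
      (Fin n))).toIsometryEquiv.measurePreserving_hausdorffMeasure _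
  have h := hmp.setIntegral_preimage_emb (Homeomorph.neg
    (EuclideanSpace ℝ (Fin n))).measurableEmbedding
    (fun θ => suppFn {p} θ) (sphere (0 : EuclideanSpace ℝ (Fin n)) 1)
  have hpre : (fun x : EuclideanSpace ℝ (Fin n) => -x) ⁻¹' (sphere 0 1) = sphere 0 1 := by
    ext x; simp
  have hs : ∀ θ, suppFn ({p} : Set (EuclideanSpace ℝ (Fin n))) θ = ⟪θ, p⟫ := by
    intro θ; simp [suppFn]
  rw [hpre] at h
  simp only [hs, inner_neg_left, integral_neg] at h
  unfold meanWidth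
  simp only [hs]
  have : ∫ θ in sphere (0 : EuclideanSpace ℝ (Fin n)) 1, ⟪θ, p⟫ ∂(sphereMeasure n) = 0 := by
    linarith
  rw [this, mul_zero]

lemma aux_variation {n : ℕ} (c a b : ℝ) (hc : 0 < c) (x : ℝ → EuclideanSpace ℝ (Fin n))
    (h : ∀ t₁ t₂, a ≤ t₁ → t₁ ≤ t₂ → t₂ ≤ b →
          dist (x t₂) (x t₁) ≤
            c * (meanWidth (convexHull ℝ (x '' Icc a t₂)) -
                 meanWidth (convexHull ℝ (x '' Icc a t₁)))) :
    eVariationOn x (Icc a b) ≤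
          ENNReal.ofReal (c * meanWidth (convexHull ℝ (x '' Icc a b))) := by
  have h0 : ∀ t, a ≤ t → t ≤ b → 0 ≤ meanWidth (convexHull ℝ (x '' Icc a t)) := by
    intro t hat htb
    have h1 := dist_nonneg.trans (h a t le_rfl hat htb)
    rw [Icc_self, image_singleton, convexHull_singleton, aux_point, sub_zero] at h1
    exact nonneg_of_mul_nonneg_right h1 hc
  refine iSup_le ?_
  rintro ⟨N, u, hu, hmem⟩
  simp only [edist_dist]
  rw [← ENNReal.ofReal_sum_of_nonneg (fun _ _ => dist_nonneg)]
  refine ENNReal.ofReal_le_ofReal ?_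
  have h1 : ∑ i ∈ Finset.range N, dist (x (u (i+1))) (x (u i)) ≤
      ∑ i ∈ Finset.range N, (c * meanWidth (convexHull ℝ (x '' Icc a (u (i+1)))) -
        c * meanWidth (convexHull ℝ (x '' Icc a (u i)))) := by
    refine Finset.sum_le_sum fun i _ => ?_
    rw [← mul_sub]
    exact h _ _ (hmem i).1 (hu (Nat.le_succ i)) (hmem (i+1)).2
  rw [Finset.sum_range_sub (fun i => c * meanWidth (convexHull ℝ (x '' Icc a (u i))))] at h1
  have h2 := mul_nonneg hc.le (h0 (u 0) (hmem 0).1 (hmem 0).2)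
  have h3 := dist_nonneg.trans (h (u N) b (hmem N).1 (hmem N).2 le_rfl)
  rw [mul_sub] at h3
  linarith

/-- For a self expanding curve, the support functions differ by a definite amount on a cap. -/
lemma aux_geom {n : ℕ} (δ : ℝ) (hδ : 0 < δ)
    (hdir : ∀ U : Set (EuclideanSpace ℝ (Fin n)), U.Nonempty →
    (∀ u ∈ U, u ≠ 0) → (∀ u ∈ U, ∀ v ∈ U, 0 ≤ ⟪u, v⟫) →
    ∃ w : EuclideanSpace ℝ (Fin n), ‖w‖ = 1 ∧ ∀ u ∈ U, δ * ‖u‖ ≤ ⟪w, u⟫)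
    (a b : ℝ) (x : ℝ → EuclideanSpace ℝ (Fin n)) (hx : SelfExpanding a b x)
    (t₁ t₂ : ℝ) (h1 : a ≤ t₁) (h12 : t₁ ≤ t₂) (h2 : t₂ ≤ b) (hne : x t₂ ≠ x t₁)
    (hbd : Bornology.IsBounded (convexHull ℝ (x '' Icc a t₂))) :
    ∃ v : EuclideanSpace ℝ (Fin n), ‖v‖ = 1 ∧ ∀ θ ∈ ball v (δ / 2),
      δ / 4 * dist (x t₂) (x t₁) ≤
        suppFn (convexHull ℝ (x '' Icc a t₂)) θ - suppFn (convexHull ℝ (x '' Icc a t₁)) θ := by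
  obtain ⟨-, hse⟩ := hx
  have hd : 0 < dist (x t₂) (x t₁) := dist_pos.2 hne
  have hhalf : ∀ s ∈ Icc a t₁, dist (x t₂) (x t₁) / 2 ≤ ‖x s - x t₂‖ := by
    intro s hs
    have e1 := hse s t₁ t₂ hs.1 hs.2 h12 h2
    have e2 := dist_triangle_right (x t₂) (x t₁) (x s)
    rw [← dist_eq_norm, dist_comm (x s)]
    linarith
  have hinn : ∀ s s', a ≤ s → s ≤ s' → s' ≤ t₁ → 0 ≤ ⟪x s - x t₂, x s' - x t₂⟫ := by
    intro s s' hs hss hs'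
    have e1 := hse s s' t₂ hs hss (hs'.trans h12) h2
    rw [dist_comm, dist_comm (x t₂), dist_eq_norm, dist_eq_norm] at e1
    have e2 := norm_sub_sq_real (x s - x t₂) (x s' - x t₂)
    rw [sub_sub_sub_cancel_right] at e2
    have e3 : ‖x s - x s'‖ ^ 2 ≤ ‖x s - x t₂‖ ^ 2 := pow_le_pow_left₀ (norm_nonneg _) e1 2
    nlinarith [sq_nonneg ‖x s' - x t₂‖]
  obtain ⟨w, hw, hwU⟩ := hdir ((fun s => x s - x t₂) '' Icc a t₁) ⟨_, a, ⟨le_rfl, h1⟩, rfl⟩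
    (by
      rintro _ ⟨s, hs, rfl⟩
      rw [← norm_pos_iff]
      have := hhalf s hs
      linarith)
    (by
      rintro _ ⟨s, hs, rfl⟩ _ ⟨s', hs', rfl⟩
      rcases le_total s s' with h | h
      · exact hinn s s' hs.1 h hs'.2
      · rw [real_inner_comm]; exact hinn s' s hs'.1 h hs.2)
  refine ⟨-w, by simpa using hw, fun θ hθ => ?_⟩
  have hq : ⟪θ, x t₂⟫ ≤ suppFn (convexHull ℝ (x '' Icc a t₂)) θ :=
    aux_le_supp hbd _ _ (subset_convexHull ℝ _ ⟨t₂, ⟨h1.trans h12, le_rfl⟩, rfl⟩)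
  have hp : suppFn (convexHull ℝ (x '' Icc a t₁)) θ ≤
      ⟪θ, x t₂⟫ - δ / 4 * dist (x t₂) (x t₁) := by
    refine aux_supp_hull_le (⟨x a, a, ⟨le_rfl, h1⟩, rfl⟩ : (x '' Icc a t₁).Nonempty) _ _ ?_
    rintro _ ⟨s, hs, rfl⟩
    have e1 := hwU _ ⟨s, hs, rfl⟩
    have e2 := hhalf s hs
    simp only at e1
    have e3 : ⟪θ, x s⟫ - ⟪θ, x t₂⟫ = ⟪θ - -w, x s - x t₂⟫ - ⟪w, x s - x t₂⟫ := by
      simp only [inner_sub_left, inner_sub_right, inner_neg_left]; ring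
    have e4 := real_inner_le_norm (θ - -w) (x s - x t₂)
    rw [mem_ball, dist_eq_norm] at hθ
    have e5 := mul_le_mul_of_nonneg_right hθ.le (norm_nonneg (x s - x t₂))
    nlinarith
  linarith

/-- Lipschitz bound w.r.t. the mean width and rectifiability of
self expanding curves. -/
theorem selfExpanding_lipschitz_meanWidth_and_length (n : ℕ) (hn : 1 ≤ n) :
    ∃ c : ℝ, 0 < c ∧
      ∀ (a b : ℝ) (x : ℝ → EuclideanSpace ℝ (Fin n)), SelfExpanding a b x →
        (∀ t₁ t₂, a ≤ t₁ → t₁ ≤ t₂ → t₂ ≤ b →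
          dist (x t₂) (x t₁) ≤
            c * (meanWidth (convexHull ℝ (x '' Icc a t₂)) -
                 meanWidth (convexHull ℝ (x '' Icc a t₁)))) ∧
        eVariationOn x (Icc a b) ≤
          ENNReal.ofReal (c * meanWidth (convexHull ℝ (x '' Icc a b))) := by
  obtain ⟨k, rfl⟩ : ∃ k, n = k + 1 := ⟨n - 1, by omega⟩
  have hμ : sphereMeasure (k+1) = (μH[(k:ℝ)] : Measure (EuclideanSpace ℝ (Fin (k+1)))) := by
    unfold sphereMeasure
    congr 1
    push_cast
    ring
  have hfin : sphereMeasure (k+1) (sphere (0 : EuclideanSpace ℝ (Fin (k+1))) 1) < ⊤ := by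
    rw [hμ]; exact aux_finite k
  have hA : 0 < sphereArea (k+1) := by
    refine ENNReal.toReal_pos ?_ hfin.ne
    rw [hμ]; exact (aux_pos k).ne'
  obtain ⟨δ, hδ, hdir⟩ := aux_dir (k+1)
  obtain ⟨m, hm, hcap⟩ := aux_cap k (δ / 2) (half_pos hδ)
  rw [← hμ] at hcap
  have hmtop : m ≠ ⊤ := by
    refine ne_top_of_le_ne_top hfin.ne ((hcap (EuclideanSpace.single 0 1) (by simp)).trans ?_)
    exact measure_mono inter_subset_left
  have hmr : 0 < m.toReal := ENNReal.toReal_pos hm.ne' hmtop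
  set A := sphereArea (k+1) with hAdef
  refine ⟨(2 / A * (δ / 4 * m.toReal))⁻¹, by positivity, ?_⟩
  intro a b x hx
  suffices h : ∀ t₁ t₂, a ≤ t₁ → t₁ ≤ t₂ → t₂ ≤ b →
          dist (x t₂) (x t₁) ≤ (2 / A * (δ / 4 * m.toReal))⁻¹ *
            (meanWidth (convexHull ℝ (x '' Icc a t₂)) -
                 meanWidth (convexHull ℝ (x '' Icc a t₁))) from
    ⟨h, aux_variation _ a b (by positivity) x h⟩
  intro t₁ t₂ h1 h12 h2
  rw [inv_mul_eq_div, le_div_iff₀ (by positivity)]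
  have hbd : ∀ t, t ≤ b → Bornology.IsBounded (convexHull ℝ (x '' Icc a t)) := fun t ht =>
    isBounded_convexHull.2 (isCompact_Icc.image_of_continuousOn
      (hx.1.mono (Icc_subset_Icc_right ht))).isBounded
  have hne : ∀ t, a ≤ t → (convexHull ℝ (x '' Icc a t)).Nonempty := fun t ht =>
    Set.Nonempty.convexHull ⟨_, a, ⟨le_rfl, ht⟩, rfl⟩
  have hi1 := aux_int (hbd t₁ (h12.trans h2)) (hne t₁ h1) hfin
  have hi2 := aux_int (hbd t₂ h2) (hne t₂ (h1.trans h12)) hfin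
  have hmono : ∀ θ, 0 ≤ suppFn (convexHull ℝ (x '' Icc a t₂)) θ -
      suppFn (convexHull ℝ (x '' Icc a t₁)) θ := by
    intro θ
    refine sub_nonneg.2 (aux_supp_hull_le (⟨x a, a, ⟨le_rfl, h1⟩, rfl⟩ : (x '' Icc a t₁).Nonempty) _ _ fun y hy => ?_)
    exact aux_le_supp (hbd t₂ h2) _ _
      (subset_convexHull ℝ _ (image_mono (Icc_subset_Icc_right h12) hy))
  have hdiff : meanWidth (convexHull ℝ (x '' Icc a t₂)) - meanWidth (convexHull ℝ (x '' Icc a t₁))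
      = 2 / A * ∫ θ in sphere (0 : EuclideanSpace ℝ (Fin (k+1))) 1,
        (suppFn (convexHull ℝ (x '' Icc a t₂)) θ - suppFn (convexHull ℝ (x '' Icc a t₁)) θ)
          ∂(sphereMeasure (k+1)) := by
    rw [integral_sub hi2 hi1, mul_sub]
    rfl
  rw [hdiff]
  rw [show dist (x t₂) (x t₁) * (2 / A * (δ / 4 * m.toReal)) =
    2 / A * (δ / 4 * dist (x t₂) (x t₁) * m.toReal) by ring]
  refine mul_le_mul_of_nonneg_left ?_ (by positivity)
  rcases eq_or_ne (x t₂) (x t₁) with heq | hneq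
  · rw [heq, dist_self, mul_zero, zero_mul]
    exact integral_nonneg hmono
  obtain ⟨v, hv, hvθ⟩ := aux_geom δ hδ hdir a b x hx t₁ t₂ h1 h12 h2 hneq (hbd t₂ h2)
  have hcm : MeasurableSet (sphere (0 : EuclideanSpace ℝ (Fin (k+1))) 1 ∩ ball v (δ / 2)) :=
    isClosed_sphere.measurableSet.inter isOpen_ball.measurableSet
  have hcfin : sphereMeasure (k+1) (sphere (0 : EuclideanSpace ℝ (Fin (k+1))) 1 ∩ ball v (δ / 2))
      ≠ ⊤ := ne_top_of_le_ne_top hfin.ne (measure_mono inter_subset_left)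
  have hint := (hi2.sub hi1)
  calc δ / 4 * dist (x t₂) (x t₁) * m.toReal
      ≤ δ / 4 * dist (x t₂) (x t₁) * (sphereMeasure (k+1)).real
          (sphere (0 : EuclideanSpace ℝ (Fin (k+1))) 1 ∩ ball v (δ / 2)) :=
        mul_le_mul_of_nonneg_left (ENNReal.toReal_mono hcfin (hcap v hv))
          (mul_nonneg (by positivity) dist_nonneg)
    _ ≤ ∫ θ in sphere (0 : EuclideanSpace ℝ (Fin (k+1))) 1 ∩ ball v (δ / 2),
        (suppFn (convexHull ℝ (x '' Icc a t₂)) θ - suppFn (convexHull ℝ (x '' Icc a t₁)) θ)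
          ∂(sphereMeasure (k+1)) :=
        setIntegral_ge_of_const_le_real hcm hcfin (fun θ hθ => hvθ θ hθ.2)
          (IntegrableOn.mono_set hint inter_subset_left)
    _ ≤ _ := setIntegral_mono_set hint (Filter.Eventually.of_forall hmono)
        (LE.le.eventuallyLE inter_subset_left)

end
end
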